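/- Let μ ≥ 2 and 0 < θ ≤ 1 with θ ≥ μ^{-1/2}, and let 6 ≤ q ≤ ∞. Then there is a constant C, independent of μ, θ, and q, such that ∫₀¹ (μ^{-1} + t)^{-(1 - 2/q)} (μ^{-1}θ^{-2} + t)^{-(1/2)(1 - 2/q)} dt ≤ C μ^{(3/2)(1 - 2/q) - 1} (log μ) θ^{1 - 6/q}. -/

import Mathlib

open MeasureTheory
open scoped ENNReal

theorem setIntegral_Ioc_inv_add {m : ℝ} (hm : 0 < m) :
    ∫ t in Set.Ioc (0 : ℝ) 1, (m + t)⁻¹ = Real.log ((m + 1) / m) := by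
  rw [← intervalIntegral.integral_of_le zero_le_one,
    intervalIntegral.integral_comp_add_left (fun x => x⁻¹) m, add_zero,
    integral_inv_of_pos hm (by linarith)]

theorem integrableOn_Ioc_inv_add {m : ℝ} (hm : 0 < m) :
    IntegrableOn (fun t : ℝ => (m + t)⁻¹) (Set.Ioc 0 1) := by
  refine (ContinuousOn.integrableOn_Icc ?_).mono_set Set.Ioc_subset_Icc_self
  exact ContinuousOn.inv₀ (by fun_prop) fun t ht => by linarith [ht.1]

theorem rpow_mul_rpow_le_inv_mul_rpow {m b t s : ℝ} (hm : 0 < m) (hmb : m ≤ b) (ht : 0 ≤ t)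
    (hs0 : 0 ≤ s) (hs : s ≤ 1 / 3) :
    (m + t) ^ (-(1 - s)) * (b + t) ^ (-(1 / 2 : ℝ) * (1 - s)) ≤
      (m + t)⁻¹ * b ^ (1 - (3 / 2 : ℝ) * (1 - s)) := by
  have hmt : 0 < m + t := by linarith
  have hb : 0 < b := by linarith
  have hbt : 0 < b + t := by linarith
  calc (m + t) ^ (-(1 - s)) * (b + t) ^ (-(1 / 2 : ℝ) * (1 - s))
      = (m + t)⁻¹ * ((m + t) ^ s * (b + t) ^ (-(1 / 2 : ℝ) * (1 - s))) := by
        rw [← Real.rpow_neg_one, ← mul_assoc, ← Real.rpow_add hmt]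
        ring_nf
    _ ≤ (m + t)⁻¹ * ((b + t) ^ s * (b + t) ^ (-(1 / 2 : ℝ) * (1 - s))) := by gcongr
    _ = (m + t)⁻¹ * (b + t) ^ (1 - (3 / 2 : ℝ) * (1 - s)) := by
        rw [← Real.rpow_add hbt]
        ring_nf
    _ ≤ (m + t)⁻¹ * b ^ (1 - (3 / 2 : ℝ) * (1 - s)) := by
        refine mul_le_mul_of_nonneg_left ?_ (inv_nonneg.2 hmt.le)
        exact Real.rpow_le_rpow_of_nonpos hb (by linarith) (by linarith)

theorem ENNReal.toReal_two_div_le_one_third {q : ℝ≥0∞} (hq : 6 ≤ q) :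
    (2 / q).toReal ≤ 1 / 3 := by
  have h : 2 / q ≤ ENNReal.ofReal (1 / 3) := by
    refine (ENNReal.div_le_div_left hq 2).trans ?_
    rw [ENNReal.le_ofReal_iff_toReal_le (by finiteness) (by norm_num), ENNReal.toReal_div]
    norm_num
  exact ENNReal.toReal_le_of_le_ofReal (by norm_num) h

theorem Real.log_one_add_le_two_mul_log {x : ℝ} (hx : 2 ≤ x) :
    Real.log (1 + x) ≤ 2 * Real.log x := by
  have h := Real.log_le_log (by linarith) (by nlinarith : 1 + x ≤ x ^ 2)
  simpa [Real.log_pow] using h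

/-- The integral bound used with Schur's lemma in Lemma 6.1 (`n = 3`):
for `μ ≥ 2`, `μ^{-1/2} ≤ θ ≤ 1` and `6 ≤ q ≤ ∞` (with `2/q = 0` for `q = ∞`),
`∫₀¹ (μ⁻¹+t)^{-(1-2/q)} (μ⁻¹θ⁻²+t)^{-(1/2)(1-2/q)} dt
  ≤ C μ^{(3/2)(1-2/q)-1} (log μ) θ^{1-6/q}`, with `C` independent of `μ, θ, q`. -/
theorem stmt_4 :
    ∃ C : ℝ, 0 < C ∧ ∀ (μ θ : ℝ) (q : ℝ≥0∞),
      2 ≤ μ → 0 < θ → θ ≤ 1 → μ ^ (-(1 : ℝ) / 2) ≤ θ → 6 ≤ q →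
      (∫ t in Set.Ioc (0 : ℝ) 1,
          (μ⁻¹ + t) ^ (-(1 - (2 / q).toReal)) *
            (μ⁻¹ * θ ^ (-(2 : ℝ)) + t) ^ (-(1 / 2 : ℝ) * (1 - (2 / q).toReal))) ≤
        C * μ ^ ((3 / 2 : ℝ) * (1 - (2 / q).toReal) - 1) * Real.log μ *
          θ ^ (1 - 3 * (2 / q).toReal) := by
  refine ⟨2, two_pos, fun μ θ q hμ hθ0 hθ1 _ hq => ?_⟩
  have hs := ENNReal.toReal_two_div_le_one_third hq
  have hs0 : 0 ≤ (2 / q).toReal := ENNReal.toReal_nonneg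
  generalize (2 / q).toReal = s at hs hs0 ⊢
  have hμ0 : 0 < μ := by linarith
  have hm : 0 < μ⁻¹ := inv_pos.2 hμ0
  have hmb : μ⁻¹ ≤ μ⁻¹ * θ ^ (-(2 : ℝ)) :=
    le_mul_of_one_le_right hm.le (Real.one_le_rpow_of_pos_of_le_one_of_nonpos hθ0 hθ1 (by norm_num))
  have hpow : (μ⁻¹ * θ ^ (-(2 : ℝ))) ^ (1 - (3 / 2 : ℝ) * (1 - s)) =
      μ ^ ((3 / 2 : ℝ) * (1 - s) - 1) * θ ^ (1 - 3 * s) := by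
    rw [Real.mul_rpow hm.le (by positivity), ← Real.rpow_neg_one, ← Real.rpow_mul hμ0.le,
      ← Real.rpow_mul hθ0.le]
    ring_nf
  have hlog : (μ⁻¹ + 1) / μ⁻¹ = 1 + μ := by field_simp
  calc _ ≤ ∫ t in Set.Ioc (0 : ℝ) 1,
        (μ⁻¹ + t)⁻¹ * (μ⁻¹ * θ ^ (-(2 : ℝ))) ^ (1 - (3 / 2 : ℝ) * (1 - s)) := by
        refine integral_mono_of_nonneg ?_ ((integrableOn_Ioc_inv_add hm).mul_const _) ?_
        · filter_upwards [ae_restrict_mem measurableSet_Ioc] with t ht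
          have := ht.1
          simp only [Pi.zero_apply]
          positivity
        · filter_upwards [ae_restrict_mem measurableSet_Ioc] with t ht
          exact rpow_mul_rpow_le_inv_mul_rpow hm hmb ht.1.le hs0 hs
    _ = Real.log (1 + μ) * (μ ^ ((3 / 2 : ℝ) * (1 - s) - 1) * θ ^ (1 - 3 * s)) := by
        rw [integral_mul_const, setIntegral_Ioc_inv_add hm, hlog, hpow]
    _ ≤ 2 * Real.log μ * (μ ^ ((3 / 2 : ℝ) * (1 - s) - 1) * θ ^ (1 - 3 * s)) := by
        gcongr
        exact Real.log_one_add_le_two_mul_log hμ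
    _ = _ := by ring
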